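/- D(x_1^{m_1}·ζ_1^{m_2}) = 0 for all nonnegative integers m_1, m_2. -/

import Mathlib

open MvPolynomial
open scoped Fin.NatCast

noncomputable section

abbrev A : Type := MvPolynomial (Fin 27) ℂ

/-- the variable `x_i` (1-based indexing). -/
def xv (i : ℕ) : A := X ((i - 1 : ℕ) : Fin 27)

/-- the partial derivative `∂_i` (1-based indexing) as a linear operator. -/
def pdE (i : Fin 27) : Module.End ℂ A := (pderiv i).toLinearMap

/-- the operator `x_a ∂_b` (1-based indexing). -/
def md (a b : ℕ) : Module.End ℂ A :=
  (LinearMap.mulLeft ℂ (xv a)) ∘ₗ pdE ((b - 1 : ℕ) : Fin 27)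

/-- the actions `e_1, …, e_6` of the simple positive root vectors of `E₆`. -/
def eOp : ℕ → Module.End ℂ A
  | 1 => -md 1 2 + md 11 14 + md 15 17 + md 16 19 + md 18 21 + md 20 23
  | 2 => -md 4 6 - md 5 7 - md 8 10 + md 18 20 + md 21 23 + md 22 24
  | 3 => -md 2 3 + md 9 11 + md 12 15 + md 13 16 + md 21 22 + md 23 24
  | 4 => -md 3 4 - md 7 9 - md 10 12 - md 16 18 - md 19 21 + md 24 25
  | 5 => -md 4 5 - md 6 7 - md 12 13 - md 15 16 - md 17 19 + md 25 26
  | 6 => -md 5 8 - md 7 10 - md 9 12 - md 11 15 - md 14 17 + md 26 27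
  | _ => 0

/-- the actions `f_1, …, f_6` of the simple negative root vectors of `E₆`. -/
def fOp : ℕ → Module.End ℂ A
  | 1 => md 2 1 - md 14 11 - md 17 15 - md 19 16 - md 21 18 - md 23 20
  | 2 => md 6 4 + md 7 5 + md 10 8 - md 20 18 - md 23 21 - md 24 22
  | 3 => md 3 2 - md 11 9 - md 15 12 - md 16 13 - md 22 21 - md 24 23
  | 4 => md 4 3 + md 9 7 + md 12 10 + md 18 16 + md 21 19 - md 25 24
  | 5 => md 5 4 + md 7 6 + md 13 12 + md 16 15 + md 19 17 - md 26 25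
  | 6 => md 8 5 + md 10 7 + md 12 9 + md 15 11 + md 17 14 - md 27 26
  | _ => 0

/-- the involution of `{0,…,26}` fixing `12, 13, 14` (0-based version of ι). -/
def iotaF : Fin 27 → Fin 27 := fun j =>
  if j.val = 12 ∨ j.val = 13 ∨ j.val = 14 then j else ⟨26 - j.val, by omega⟩

/-- the algebra automorphism τ of `A`. -/
def tau : A →ₐ[ℂ] A := rename iotaF

def z1 : A := xv 1 * xv 14 + xv 2 * xv 11 + xv 3 * xv 9 - xv 4 * xv 7 + xv 5 * xv 6
def z2 : A := fOp 6 z1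
def z3 : A := fOp 5 z2
def z4 : A := fOp 4 z3
def z5 : A := fOp 3 z4
def z6 : A := fOp 2 z4
def z7 : A := fOp 3 z6
def z8 : A := fOp 1 z5
def z9 : A := fOp 4 z7
def z10 : A := fOp 1 z7
def z11 : A := -(fOp 5 z9)
def z12 : A := fOp 4 z10
def z13 : A := fOp 3 z12
def z14 : A := -(fOp 6 z11)
def z15 : A := -(fOp 5 z12)

/-- the quadratic polynomials `ζ_1, …, ζ_27` (1-based indexing). -/
def zeta : ℕ → A
  | 1 => z1 | 2 => z2 | 3 => z3 | 4 => z4 | 5 => z5 | 6 => z6 | 7 => z7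
  | 8 => z8 | 9 => z9 | 10 => z10 | 11 => z11 | 12 => z12 | 13 => z13
  | 14 => z14 | 15 => z15
  | 16 => tau z12 | 17 => tau z11 | 18 => tau z10 | 19 => tau z9
  | 20 => tau z8 | 21 => tau z7 | 22 => tau z6 | 23 => tau z5
  | 24 => tau z4 | 25 => tau z3 | 26 => tau z2 | 27 => tau z1
  | _ => 0

/-- the involution ι of `{1,…,27}` fixing `13, 14, 15`. -/
def iotaN (i : ℕ) : ℕ := if i = 13 ∨ i = 14 ∨ i = 15 then i else 28 - i

/-- the signs ε_i. -/
def eps (i : ℕ) : ℂ :=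
  if i = 9 ∨ i = 11 ∨ i = 12 ∨ i = 13 ∨ i = 14 ∨ i = 15 ∨ i = 16 ∨ i = 17 ∨ i = 19
  then -1 else 1

/-- the `E₆`-invariant cubic polynomial η (Dickson's trilinear form). -/
def eta : A := ∑ i ∈ Finset.Icc 1 27, eps i • (xv i * zeta (iotaN i))

lemma pderiv_swap (i j : Fin 27) (p : A) :
    pderiv i (pderiv j p) = pderiv j (pderiv i p) := by
  induction p using MvPolynomial.induction_on with
  | C a => simp
  | add p q hp hq => simp [hp, hq]
  | mul_X p k ih =>
      have h1 : pderiv i ((pderiv j) (X k) : A) = 0 := by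
        rcases eq_or_ne j k with h | h
        · subst h; simp [pderiv_X_self]
        · simp [pderiv_X_of_ne (Ne.symm h)]
      have h2 : pderiv j ((pderiv i) (X k) : A) = 0 := by
        rcases eq_or_ne i k with h | h
        · subst h; simp [pderiv_X_self]
        · simp [pderiv_X_of_ne (Ne.symm h)]
      simp only [pderiv_mul, map_add, ih, h1, h2]
      ring

lemma pdE_comm (i j : Fin 27) : Commute (pdE i) (pdE j) := by
  refine LinearMap.ext fun p => ?_
  simpa [pdE, Module.End.mul_apply] using pderiv_swap i j p

/-- `Im(g)`: the constant-coefficient differential operator obtained from `g` by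
replacing each variable `x_i` by `∂_i`. -/
def Imo (g : A) : Module.End ℂ A :=
  ∑ d ∈ g.support, g.coeff d •
    Finset.univ.noncommProd (fun i : Fin 27 => pdE i ^ d i)
      (fun i _ j _ _ => (pdE_comm i j).pow_pow _ _)

/-- the invariant operator `D = Im(η)`. -/
def Dop : Module.End ℂ A := Imo eta

/-- the Euler operator `D₁`. -/
def D1 : Module.End ℂ A := ∑ i : Fin 27, (LinearMap.mulLeft ℂ (X i : A)) ∘ₗ pdE i

/-- the invariant operator `D₂ = Σ ζ_i · Im(ζ_i)`. -/
def D2 : Module.End ℂ A :=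
  ∑ i ∈ Finset.Icc 1 27, (LinearMap.mulLeft ℂ (zeta i)) ∘ₗ Imo (zeta i)


/-- The indices (0-based) of the variables occurring in `ζ₁`. -/
def zetaOneVars : Finset (Fin 27) := {0, 1, 2, 3, 4, 5, 6, 8, 10, 13}

/-- The ideal generated by the variables that do not occur in `ζ₁`. -/
def complIdeal : Ideal A := Ideal.span (X '' {i | i ∉ zetaOneVars})

lemma md_mul (a b : ℕ) (p q : A) : md a b (p * q) = md a b p * q + p * md a b q := by
  have h (r : A) : md a b r = xv a * pderiv ((b - 1 : ℕ) : Fin 27) r := rfl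
  simp only [h, pderiv_mul]
  ring

lemma md_xv (a b c : ℕ) :
    md a b (xv c) =
      if ((c - 1 : ℕ) : Fin 27) = ((b - 1 : ℕ) : Fin 27) then xv a else 0 := by
  change xv a * pderiv ((b - 1 : ℕ) : Fin 27) (X ((c - 1 : ℕ) : Fin 27)) = _
  rw [pderiv_X, Pi.single_apply, mul_ite, mul_one, mul_zero]

lemma z2_eq : z2 =
    xv 1 * xv 17 + xv 2 * xv 15 + xv 3 * xv 12 - xv 4 * xv 10 + xv 6 * xv 8 := by
  simp [z2, z1, fOp, md_mul, md_xv]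
  ring

lemma z3_eq : z3 =
    xv 1 * xv 19 + xv 2 * xv 16 + xv 3 * xv 13 - xv 5 * xv 10 + xv 7 * xv 8 := by
  simp [z3, z2_eq, fOp, md_mul, md_xv]
  ring

lemma z4_eq : z4 =
    xv 1 * xv 21 + xv 2 * xv 18 + xv 4 * xv 13 - xv 5 * xv 12 + xv 8 * xv 9 := by
  simp [z4, z3_eq, fOp, md_mul, md_xv]
  ring

lemma z5_eq : z5 =
    -(xv 1 * xv 22) + xv 3 * xv 18 - xv 4 * xv 16 + xv 5 * xv 15 - xv 8 * xv 11 := by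
  simp [z5, z4_eq, fOp, md_mul, md_xv]
  ring

lemma z6_eq : z6 =
    -(xv 1 * xv 23) - xv 2 * xv 20 + xv 6 * xv 13 - xv 7 * xv 12 + xv 9 * xv 10 := by
  simp [z6, z4_eq, fOp, md_mul, md_xv]
  ring

lemma z7_eq : z7 =
    xv 1 * xv 24 - xv 3 * xv 20 - xv 6 * xv 16 + xv 7 * xv 15 - xv 10 * xv 11 := by
  simp [z7, z6_eq, fOp, md_mul, md_xv]
  ring

lemma z9_eq : z9 =
    -(xv 1 * xv 25) - xv 4 * xv 20 - xv 6 * xv 18 + xv 9 * xv 15 - xv 11 * xv 12 := by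
  simp [z9, z7_eq, fOp, md_mul, md_xv]
  ring

lemma z11_eq : z11 =
    -(xv 1 * xv 26) + xv 5 * xv 20 + xv 7 * xv 18 - xv 9 * xv 16 + xv 11 * xv 13 := by
  simp [z11, z9_eq, fOp, md_mul, md_xv]
  ring

lemma z14_eq : z14 =
    -(xv 1 * xv 27) - xv 8 * xv 20 - xv 10 * xv 18 + xv 12 * xv 16 - xv 13 * xv 15 := by
  simp [z14, z11_eq, fOp, md_mul, md_xv]
  ring

lemma xv_mem_complIdeal {n : ℕ} (h : ((n - 1 : ℕ) : Fin 27) ∉ zetaOneVars) :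
    xv n ∈ complIdeal :=
  Ideal.subset_span ⟨_, h, rfl⟩

lemma tau_xv_mem_complIdeal {n : ℕ} (h : iotaF ((n - 1 : ℕ) : Fin 27) ∉ zetaOneVars) :
    tau (xv n) ∈ complIdeal :=
  Ideal.subset_span ⟨_, h, by simp [tau, xv]⟩

lemma zeta_iotaN_mem_complIdeal {i : ℕ}
    (h : i ∈ ({1, 2, 3, 4, 5, 6, 7, 9, 11, 14} : Finset ℕ)) :
    zeta (iotaN i) ∈ complIdeal := by
  fin_cases h <;>
  simp only [iotaN, zeta, z1, z2_eq, z3_eq, z4_eq, z5_eq, z6_eq, z7_eq, z9_eq, z11_eq, z14_eq,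
    map_add, map_sub, map_neg, map_mul, Nat.reduceEqDiff, or_self, or_true, or_false, if_true,
    if_false, Nat.reduceSub] <;>
  repeat' first
    | apply Ideal.add_mem
    | apply Ideal.sub_mem
    | apply complIdeal.neg_mem
    | exact Ideal.mul_mem_left _ _ (xv_mem_complIdeal (by decide))
    | exact Ideal.mul_mem_left _ _ (tau_xv_mem_complIdeal (by decide))
    | exact Ideal.mul_mem_right _ _ (tau_xv_mem_complIdeal (by decide))

lemma eta_mem_complIdeal : eta ∈ complIdeal := by
  refine Ideal.sum_mem _ fun i hi => Submodule.smul_of_tower_mem _ _ ?_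
  by_cases h : i ∈ ({1, 2, 3, 4, 5, 6, 7, 9, 11, 14} : Finset ℕ)
  · exact Ideal.mul_mem_left _ _ (zeta_iotaN_mem_complIdeal h)
  · refine Ideal.mul_mem_right _ _ (xv_mem_complIdeal ?_)
    revert i
    decide

lemma noncommProd_pdE_apply_eq_zero {d : Fin 27 →₀ ℕ} {i : Fin 27} (hd : d i ≠ 0) {p : A}
    (hp : pdE i p = 0) :
    Finset.univ.noncommProd (fun i : Fin 27 => pdE i ^ d i)
      (fun i _ j _ _ => (pdE_comm i j).pow_pow _ _) p = 0 := by
  obtain ⟨k, hk⟩ := Nat.exists_eq_succ_of_ne_zero hd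
  refine (LinearMap.congr_fun (Finset.noncommProd_erase_mul _ (Finset.mem_univ i)
    (fun i : Fin 27 => pdE i ^ d i) fun i _ j _ _ => (pdE_comm i j).pow_pow _ _).symm p).trans ?_
  rw [Module.End.mul_apply, hk, pow_succ, Module.End.mul_apply, hp, map_zero, map_zero]

/-- `Im(g)` kills `p` if every monomial of `g` involves a variable on which `p` does not depend. -/
lemma Imo_apply_eq_zero {g p : A} {s : Set (Fin 27)}
    (hg : g ∈ Ideal.span (X '' s : Set A)) (hp : ∀ i ∈ s, pdE i p = 0) : Imo g p = 0 := by
  rw [Imo, LinearMap.sum_apply]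
  refine Finset.sum_eq_zero fun d hd => ?_
  obtain ⟨i, hi, hdi⟩ := mem_ideal_span_X_image.1 hg d hd
  rw [LinearMap.smul_apply, noncommProd_pdE_apply_eq_zero hdi (hp i hi), smul_zero]

lemma pderiv_xv_of_notMem {i : Fin 27} (hi : i ∉ zetaOneVars) {n : ℕ}
    (hn : ((n - 1 : ℕ) : Fin 27) ∈ zetaOneVars) : pderiv i (xv n) = 0 :=
  pderiv_X_of_ne fun h => hi (h ▸ hn)

lemma pderiv_zeta_one {i : Fin 27} (hi : i ∉ zetaOneVars) : pderiv i (zeta 1) = 0 := by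
  have h {n : ℕ} (hn : ((n - 1 : ℕ) : Fin 27) ∈ zetaOneVars) := pderiv_xv_of_notMem hi hn
  rw [zeta, z1]
  simp only [map_add, map_sub, pderiv_mul]
  rw [h (n := 1) (by decide), h (n := 2) (by decide), h (n := 3) (by decide),
    h (n := 4) (by decide), h (n := 5) (by decide), h (n := 6) (by decide),
    h (n := 7) (by decide), h (n := 9) (by decide), h (n := 11) (by decide),
    h (n := 14) (by decide)]
  simp

/-- `D(x₁^{m₁} ζ₁^{m₂}) = 0`. -/
theorem stmt9 (m1 m2 : ℕ) : Dop (xv 1 ^ m1 * zeta 1 ^ m2) = 0 := by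
  refine Imo_apply_eq_zero eta_mem_complIdeal fun i hi => ?_
  have hx : pderiv i (xv 1) = 0 := pderiv_xv_of_notMem hi (by decide)
  simp [pdE, Derivation.leibniz_pow, hx, pderiv_zeta_one hi]

end
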